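/- Let X be a locally finite poset and let Φ₁ and Φ₂ be involutions on D(X,K), with induced involutions ρ₁, ρ₂ on A given by ρ_j(f) = first component of Φ_j(f,0). If there exists a K-algebra automorphism Ψ of D(X,K) such that Ψ ∘ Φ₁ = Φ₂ ∘ Ψ, then the map η : A → A, η(f) = first component of Ψ(f,0), is a K-algebra automorphism of A satisfying η ∘ ρ₁ = ρ₂ ∘ η. If moreover Ψ is an inner automorphism of D(X,K), then η is an inner automorphism of A. -/

import Mathlib

open TrivSqZeroExt

namespace TrivSqZeroExt

theorem inr_one_mul_comm {R : Type*} [Semiring R] (u : TrivSqZeroExt R R) :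
    inr 1 * u = u * inr 1 := by
  ext <;> simp

/-- An additive map preserving the square-zero ideal has first component depending only on the
first component of its argument. -/
theorem fst_map_inl_fst {R M : Type*} [AddZeroClass R] [AddZeroClass M]
    {T : TrivSqZeroExt R M → TrivSqZeroExt R M}
    (hadd : ∀ u v, T (u + v) = T u + T v) (hinr : ∀ a, (T (inr a)).fst = 0)
    (u : TrivSqZeroExt R M) : (T (inl u.fst)).fst = (T u).fst := by
  conv_rhs => rw [← inl_fst_add_inr_snd_eq u, hadd, fst_add, hinr, add_zero]

end TrivSqZeroExt

namespace IncidenceAlgebra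

variable {K X : Type*} [Field K] [PartialOrder X] [LocallyFiniteOrder X] [DecidableEq X]

/-- A central element of the incidence algebra whose square is zero vanishes. -/
theorem eq_zero_of_central_of_sq_eq_zero {c : IncidenceAlgebra K X}
    (hc : ∀ a, c * a = a * c) (hsq : c * c = 0) : c = 0 := by
  have diag : ∀ x, c x x = 0 := by
    intro x
    have h := congrArg (fun f : IncidenceAlgebra K X => f x x) hsq
    simpa [mul_apply] using h
  ext x y hxy
  by_cases hne : x = y
  · subst hne
    simpa using diag x
  let e : IncidenceAlgebra K X :=
    ⟨fun a b => if a = x ∧ b = x then 1 else 0, by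
      rintro a b hab
      rw [if_neg]
      rintro ⟨rfl, rfl⟩
      exact hab le_rfl⟩
  have he : ∀ a b, e a b = if a = x ∧ b = x then 1 else 0 := fun _ _ => rfl
  have h := congrArg (fun f : IncidenceAlgebra K X => f x y) (hc e)
  simpa [mul_apply, he, Ne.symm hne, hxy] using h.symm

/-- Central square-zero elements of the idealization lie in the ideal of elements with zero first
component. -/
theorem fst_eq_zero_of_central_of_sq_eq_zero
    {z : TrivSqZeroExt (IncidenceAlgebra K X) (IncidenceAlgebra K X)}
    (hz : ∀ u, z * u = u * z) (hsq : z * z = 0) : z.fst = 0 := by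
  refine eq_zero_of_central_of_sq_eq_zero (fun a => ?_) ?_
  · simpa using congrArg fst (hz (inl a))
  · simpa using congrArg fst hsq

/-- Surjective multiplicative maps preserve the square-zero ideal. -/
theorem fst_map_inr_eq_zero
    {T : TrivSqZeroExt (IncidenceAlgebra K X) (IncidenceAlgebra K X) →
      TrivSqZeroExt (IncidenceAlgebra K X) (IncidenceAlgebra K X)}
    (h0 : T 0 = 0) (hmul : ∀ u v, T (u * v) = T u * T v) (hT : Function.Surjective T)
    (a : IncidenceAlgebra K X) : (T (inr a)).fst = 0 := by
  have h1 : (T (inr 1)).fst = 0 := by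
    refine fst_eq_zero_of_central_of_sq_eq_zero (fun u => ?_) ?_
    · obtain ⟨v, rfl⟩ := hT u
      rw [← hmul, ← hmul, inr_one_mul_comm]
    · rw [← hmul, inr_mul_inr, h0]
  have ha : (inr a : TrivSqZeroExt (IncidenceAlgebra K X) (IncidenceAlgebra K X)) =
      inr 1 * inl a := by
    ext <;> simp
  rw [ha, hmul, fst_mul, h1, zero_mul]

/-- Surjective anti-multiplicative maps preserve the square-zero ideal. -/
theorem fst_antimap_inr_eq_zero
    {T : TrivSqZeroExt (IncidenceAlgebra K X) (IncidenceAlgebra K X) →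
      TrivSqZeroExt (IncidenceAlgebra K X) (IncidenceAlgebra K X)}
    (h0 : T 0 = 0) (hmul : ∀ u v, T (u * v) = T v * T u) (hT : Function.Surjective T)
    (a : IncidenceAlgebra K X) : (T (inr a)).fst = 0 := by
  have h1 : (T (inr 1)).fst = 0 := by
    refine fst_eq_zero_of_central_of_sq_eq_zero (fun u => ?_) ?_
    · obtain ⟨v, rfl⟩ := hT u
      rw [← hmul, ← hmul, inr_one_mul_comm]
    · rw [← hmul, inr_mul_inr, h0]
  have ha : (inr a : TrivSqZeroExt (IncidenceAlgebra K X) (IncidenceAlgebra K X)) =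
      inr 1 * inl a := by
    ext <;> simp
  rw [ha, hmul, fst_mul, h1, mul_zero]

end IncidenceAlgebra

/-- Let `Φ₁`, `Φ₂` be involutions on `D(X,K) = A(+)A`, with induced involutions
`ρⱼ(f) = fst (Φⱼ(f,0))` on `A`.  If `Ψ` is a `K`-algebra automorphism of `D(X,K)` with
`Ψ ∘ Φ₁ = Φ₂ ∘ Ψ`, then `η(f) := fst (Ψ(f,0))` is a `K`-algebra automorphism of `A`
satisfying `η ∘ ρ₁ = ρ₂ ∘ η`; and if `Ψ` is inner then `η` is inner. -/
theorem equivalence_of_involutions_descends_to_A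
    (K X : Type*) [Field K] [PartialOrder X] [LocallyFiniteOrder X] [DecidableEq X]
    (Φ₁ Φ₂ Ψ : TrivSqZeroExt (IncidenceAlgebra K X) (IncidenceAlgebra K X) →
               TrivSqZeroExt (IncidenceAlgebra K X) (IncidenceAlgebra K X))
    -- `Φ₁` is an involution
    (h1add : ∀ u v, Φ₁ (u + v) = Φ₁ u + Φ₁ v)
    (h1smul : ∀ (k : K) u, Φ₁ (k • u) = k • Φ₁ u)
    (h1anti : ∀ u v, Φ₁ (u * v) = Φ₁ v * Φ₁ u)
    (h1invo : ∀ u, Φ₁ (Φ₁ u) = u)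
    -- `Φ₂` is an involution
    (h2add : ∀ u v, Φ₂ (u + v) = Φ₂ u + Φ₂ v)
    (h2smul : ∀ (k : K) u, Φ₂ (k • u) = k • Φ₂ u)
    (h2anti : ∀ u v, Φ₂ (u * v) = Φ₂ v * Φ₂ u)
    (h2invo : ∀ u, Φ₂ (Φ₂ u) = u)
    -- `Ψ` is a `K`-algebra automorphism
    (hPadd : ∀ u v, Ψ (u + v) = Ψ u + Ψ v)
    (hPsmul : ∀ (k : K) u, Ψ (k • u) = k • Ψ u)
    (hPmul : ∀ u v, Ψ (u * v) = Ψ u * Ψ v)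
    (hPbij : Function.Bijective Ψ)
    -- `Ψ ∘ Φ₁ = Φ₂ ∘ Ψ`
    (hcomm : ∀ u, Ψ (Φ₁ u) = Φ₂ (Ψ u)) :
    -- `η` is a `K`-algebra automorphism of `A` ...
    (Function.Bijective (fun f : IncidenceAlgebra K X => (Ψ (inl f)).fst) ∧
      (∀ f g : IncidenceAlgebra K X,
        (Ψ (inl (f + g))).fst = (Ψ (inl f)).fst + (Ψ (inl g)).fst) ∧
      (∀ (k : K) (f : IncidenceAlgebra K X),
        (Ψ (inl (k • f))).fst = k • (Ψ (inl f)).fst) ∧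
      (∀ f g : IncidenceAlgebra K X,
        (Ψ (inl (f * g))).fst = (Ψ (inl f)).fst * (Ψ (inl g)).fst)) ∧
    -- ... satisfying `η ∘ ρ₁ = ρ₂ ∘ η` ...
    (∀ f : IncidenceAlgebra K X,
      (Ψ (inl ((Φ₁ (inl f)).fst))).fst = (Φ₂ (inl ((Ψ (inl f)).fst))).fst) ∧
    -- ... and if `Ψ` is inner, then `η` is inner.
    ((∃ θ : (TrivSqZeroExt (IncidenceAlgebra K X) (IncidenceAlgebra K X))ˣ,
        ∀ d, Ψ d = ↑θ * d * ↑θ⁻¹) →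
      ∃ u : (IncidenceAlgebra K X)ˣ,
        ∀ f : IncidenceAlgebra K X, (Ψ (inl f)).fst = ↑u * f * ↑u⁻¹) := by
  have hP0 : Ψ 0 = 0 := by simpa using hPadd 0 0
  have h20 : Φ₂ 0 = 0 := by simpa using h2add 0 0
  have hPinr := IncidenceAlgebra.fst_map_inr_eq_zero hP0 hPmul hPbij.surjective
  have h2inr := IncidenceAlgebra.fst_antimap_inr_eq_zero h20 h2anti
    (fun u => ⟨Φ₂ u, h2invo u⟩)
  have hPfst := fst_map_inl_fst hPadd hPinr
  have h2fst := fst_map_inl_fst h2add h2inr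
  refine ⟨⟨⟨fun f g hfg => ?_, fun g => ?_⟩, fun f g => ?_, fun k f => ?_, fun f g => ?_⟩,
    fun f => ?_, ?_⟩
  · obtain ⟨S, hS, hS'⟩ := Function.bijective_iff_has_inverse.mp hPbij
    have hSinr := IncidenceAlgebra.fst_map_inr_eq_zero (T := S)
      (hPbij.injective (by rw [hS', hP0]))
      (fun u v => hPbij.injective (by rw [hPmul, hS', hS', hS'])) hS.surjective
    have hSfst := fst_map_inl_fst (T := S)
      (fun u v => hPbij.injective (by rw [hPadd, hS', hS', hS'])) hSinr
    have h := congrArg (fun a => (S (inl a)).fst) hfg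
    simpa only [hSfst, hS _, fst_inl] using h
  · obtain ⟨u, hu⟩ := hPbij.surjective (inl g)
    exact ⟨u.fst, by simp only [hPfst, hu, fst_inl]⟩
  · rw [inl_add, hPadd, fst_add]
  · rw [inl_smul, hPsmul, fst_smul]
  · rw [inl_mul, hPmul, fst_mul]
  · rw [hPfst, h2fst, hcomm]
  · rintro ⟨θ, hθ⟩
    refine ⟨Units.map (fstHom K (IncidenceAlgebra K X) (IncidenceAlgebra K X)).toMonoidHom θ,
      fun f => ?_⟩
    rw [hθ, fst_mul, fst_mul, fst_inl]
    rfl
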